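/- Let k, s, t be positive integers with k ≥ 3 and k ≤ s − 1. Suppose that every set of s − 1 points in general position in the plane contains at least one k-hole, and that every set of s points in general position in the plane contains at least t k-holes. Then every set P of n > 2s − 2 points in general position in the plane ℝ² contains a subset P′ ⊆ P of exactly s − k + 1 points such that some line strictly separates P′ from P ∖ P′, and at least t + 1 distinct k-holes of P each contain at least one point of P′. -/

import Mathlib

open scoped Classical

noncomputable section

/-- A point in the plane. -/
abbrev Pt := ℝ × ℝ

/-- A finite point set is in general position if no three of its points are collinear. -/
def GenPos (P : Finset Pt) : Prop :=
  ∀ S ⊆ P, S.card = 3 → ¬ Collinear ℝ (S : Set Pt)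

/-- A finite set is in convex position (its points are vertices of a convex polygon)
if no point lies in the convex hull of the others. -/
def ConvexPos (S : Finset Pt) : Prop :=
  ∀ x ∈ S, x ∉ convexHull ℝ ((S : Set Pt) \ {x})

/-- `S` is a `k`-hole of `P`: a `k`-element subset of `P` in convex position whose
convex hull contains no point of `P \ S`. -/
def IsHole (k : ℕ) (P S : Finset Pt) : Prop :=
  S ⊆ P ∧ S.card = k ∧ ConvexPos S ∧
    ∀ p ∈ P, p ∈ convexHull ℝ (S : Set Pt) → p ∈ S

/-- The number of `k`-holes of `P`. -/
def numHoles (k : ℕ) (P : Finset Pt) : ℕ :=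
  (P.powerset.filter (fun S => IsHole k P S)).card

/-- `p` lies strictly to the left of the line through `x` and `y`, oriented from `x` to `y`. -/
def leftOf (x y p : Pt) : Prop :=
  0 < (y.1 - x.1) * (p.2 - x.2) - (y.2 - x.2) * (p.1 - x.1)

/-- `(x, y)` is a `j`-edge of `P`: `x, y` are distinct points of `P` and exactly `j`
points of `P` lie strictly to the left of the oriented line `xy`. -/
def IsJEdge (j : ℕ) (P : Finset Pt) (x y : Pt) : Prop :=
  x ∈ P ∧ y ∈ P ∧ x ≠ y ∧ (P.filter (fun p => leftOf x y p)).card = j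

/-- Some line strictly separates `A` from `B`. -/
def SepByLine (A B : Set Pt) : Prop :=
  ∃ u : Pt, u ≠ 0 ∧ ∃ c : ℝ,
    (∀ p ∈ A, u.1 * p.1 + u.2 * p.2 < c) ∧ (∀ q ∈ B, c < u.1 * q.1 + u.2 * q.2)

/-- linear functional -/
def FF (u p : Pt) : ℝ := u.1 * p.1 + u.2 * p.2

/-- weakly lowest `m`-subset in direction `u` -/
def WW (P : Finset Pt) (m : ℕ) (u : Pt) (A : Finset Pt) : Prop :=
  A ⊆ P ∧ A.card = m ∧ ∀ a ∈ A, ∀ b ∈ P, b ∉ A → FF u a ≤ FF u b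

lemma WW_exists (P : Finset Pt) (u : Pt) (m : ℕ) (hm : m ≤ P.card) : ∃ A, WW P m u A := by
  induction m with
  | zero => exact ⟨∅, by simp [WW]⟩
  | succ m ih =>
    obtain ⟨A, hA, hc, hl⟩ := ih (by omega)
    have hne : (P \ A).Nonempty := by
      rw [← Finset.card_pos, Finset.card_sdiff_of_subset hA]; omega
    obtain ⟨x, hx, hmin⟩ := Finset.exists_min_image (P \ A) (FF u) hne
    rw [Finset.mem_sdiff] at hx
    refine ⟨insert x A, ?_, ?_, ?_⟩
    · exact Finset.insert_subset hx.1 hA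
    · rw [Finset.card_insert_of_notMem hx.2, hc]
    · intro a ha b hb hbn
      rw [Finset.mem_insert, not_or] at hbn
      rcases Finset.mem_insert.1 ha with rfl | ha
      · exact hmin b (Finset.mem_sdiff.2 ⟨hb, hbn.2⟩)
      · exact hl a ha b hb hbn.2

lemma normsq_pos (u : Pt) (hu : u ≠ 0) : 0 < u.1 ^ 2 + u.2 ^ 2 := by
  by_contra h
  apply hu
  have h1 : u.1 = 0 := by nlinarith [sq_nonneg u.1, sq_nonneg u.2]
  have h2 : u.2 = 0 := by nlinarith [sq_nonneg u.1, sq_nonneg u.2]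
  exact Prod.ext h1 h2

lemma no_three (P : Finset Pt) (hgp : GenPos P) (u : Pt) (hu : u ≠ 0) (T : Finset Pt)
    (hT : T ⊆ P) (h3 : 3 ≤ T.card) (c : ℝ) (hc : ∀ p ∈ T, FF u p = c) : False := by
  obtain ⟨S, hS, hS3⟩ := Finset.exists_subset_card_eq h3
  refine hgp S (hS.trans hT) hS3 ?_
  have hne : S.Nonempty := by rw [← Finset.card_pos]; omega
  obtain ⟨p0, hp0⟩ := hne
  rw [collinear_iff_of_mem (p₀ := p0) (by simpa using hp0)]
  refine ⟨(-u.2, u.1), fun p hp => ?_⟩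
  have hn := normsq_pos u hu
  have e0 := hc p0 (hS hp0)
  have e1 := hc p (hS (by simpa using hp))
  unfold FF at e0 e1
  refine ⟨(-u.2 * (p.1 - p0.1) + u.1 * (p.2 - p0.2)) / (u.1 ^ 2 + u.2 ^ 2), ?_⟩
  ext
  · simp only [vadd_eq_add, Prod.fst_add, Prod.smul_fst, smul_eq_mul]
    field_simp
    linear_combination u.1 * (e1 - e0)
  · simp only [vadd_eq_add, Prod.snd_add, Prod.smul_snd, smul_eq_mul]
    field_simp
    linear_combination u.2 * (e1 - e0)

lemma conv_aux (u a : Pt) (c : ℝ) : Convex ℝ {q : Pt | FF u q < c ∨ (q = a ∧ FF u q = c)} := by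
  rw [convex_iff_forall_pos]
  intro x hx y hy α β hα hβ hab
  have hF : FF u (α • x + β • y) = α * FF u x + β * FF u y := by
    simp only [FF, Prod.fst_add, Prod.snd_add, Prod.smul_fst, Prod.smul_snd, smul_eq_mul]; ring
  have hcc : c = α * c + β * c := by rw [← add_mul, hab, one_mul]
  rcases hx with hx | ⟨rfl, hx⟩ <;> rcases hy with hy | ⟨rfl, hy⟩
  · left; rw [hF]; nlinarith [mul_lt_mul_of_pos_left hx hα, mul_lt_mul_of_pos_left hy hβ]
  · left; rw [hF]; nlinarith [mul_lt_mul_of_pos_left hx hα]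
  · left; rw [hF]; nlinarith [mul_lt_mul_of_pos_left hy hβ]
  · right
    refine ⟨?_, ?_⟩
    · rw [← add_smul, hab, one_smul]
    · rw [hF, hx]; exact hcc.symm

lemma hole_up (P : Finset Pt) (hgp : GenPos P) (u : Pt) (hu : u ≠ 0) (m k : ℕ) (A : Finset Pt)
    (hA : WW P m u A) (S : Finset Pt) (hS : IsHole k A S) : IsHole k P S := by
  obtain ⟨hAP, hc, hl⟩ := hA
  obtain ⟨hSA, hSc, hconv, hemp⟩ := hS
  refine ⟨hSA.trans hAP, hSc, hconv, fun p hp hpS => ?_⟩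
  by_cases hpA : p ∈ A
  · exact hemp p hpA hpS
  exfalso
  have huniq : ∃ a : Pt, (∀ b ∈ A, FF u b = FF u p → b = a) ∧ p ≠ a := by
    by_cases h : ∃ a ∈ A, FF u a = FF u p
    · obtain ⟨a, ha, hap⟩ := h
      refine ⟨a, fun b hb hbp => ?_, fun h => hpA (h ▸ ha)⟩
      by_contra hne
      refine no_three P hgp u hu {a, b, p} ?_ ?_ (FF u p) ?_
      · intro x hx
        simp only [Finset.mem_insert, Finset.mem_singleton] at hx
        rcases hx with rfl | rfl | rfl
        exacts [hAP ha, hAP hb, hp]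
      · rw [Finset.card_eq_three.2 ⟨a, b, p, Ne.symm hne, fun h => hpA (h ▸ ha),
          fun h => hpA (h ▸ hb), rfl⟩]
      · intro x hx
        simp only [Finset.mem_insert, Finset.mem_singleton] at hx
        rcases hx with rfl | rfl | rfl
        exacts [hap, hbp, rfl]
    · push Not at h
      exact ⟨p + (1, 0), fun b hb hbp => absurd hbp (h b hb), fun h => by
        have := congrArg Prod.fst h
        simp at this⟩
  obtain ⟨a, ha, hpa⟩ := huniq
  have hsub : (S : Set Pt) ⊆ {q : Pt | FF u q < FF u p ∨ (q = a ∧ FF u q = FF u p)} := by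
    intro b hb
    have hbA := hSA (Finset.mem_coe.1 hb)
    rcases (hl b hbA p hp hpA).lt_or_eq with h | h
    · exact Or.inl h
    · exact Or.inr ⟨ha b hbA h, h⟩
  rcases convexHull_min hsub (conv_aux u a _) hpS with h | h
  · exact lt_irrefl _ h
  · exact hpa h.1

open Filter Topology in
lemma perturb (P : Finset Pt) (u : Pt) (hu : u ≠ 0) :
    ∃ v : Pt, ∀ p ∈ P, ∀ q ∈ P, p ≠ q →
      FF v p ≠ FF v q ∧ (FF u p < FF u q → FF v p < FF v q) := by
  have key : ∀ᶠ ε : ℝ in 𝓝[>] 0, ∀ p ∈ P, ∀ q ∈ P, p ≠ q →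
      FF (u.1 - ε * u.2, u.2 + ε * u.1) p ≠ FF (u.1 - ε * u.2, u.2 + ε * u.1) q ∧
      (FF u p < FF u q →
        FF (u.1 - ε * u.2, u.2 + ε * u.1) p < FF (u.1 - ε * u.2, u.2 + ε * u.1) q) := by
    rw [Filter.eventually_all_finset]
    intro p hp
    rw [Filter.eventually_all_finset]
    intro q hq
    have hlt : ∀ p q : Pt, FF u p < FF u q → ∀ᶠ ε : ℝ in 𝓝[>] 0,
        FF (u.1 - ε * u.2, u.2 + ε * u.1) p < FF (u.1 - ε * u.2, u.2 + ε * u.1) q := by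
      intro p q h
      apply Filter.Eventually.filter_mono nhdsWithin_le_nhds
      have c1 : Continuous fun ε : ℝ => FF (u.1 - ε * u.2, u.2 + ε * u.1) p := by
        unfold FF; fun_prop
      have c2 : Continuous fun ε : ℝ => FF (u.1 - ε * u.2, u.2 + ε * u.1) q := by
        unfold FF; fun_prop
      apply c1.continuousAt.eventually_lt c2.continuousAt
      simpa [FF] using h
    rcases lt_trichotomy (FF u p) (FF u q) with h | h | h
    · filter_upwards [hlt p q h] with ε h1 _ using ⟨h1.ne, fun _ => h1⟩
    · filter_upwards [self_mem_nhdsWithin] with ε hε hne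
      refine ⟨fun h2 => hne ?_, fun h' => absurd h h'.ne⟩
      have hε : (ε : ℝ) ≠ 0 := ne_of_gt hε
      have hn := (normsq_pos u hu).ne'
      unfold FF at h h2
      simp only at h2
      have h3 : -u.2 * (p.1 - q.1) + u.1 * (p.2 - q.2) = 0 := by
        apply mul_left_cancel₀ hε
        linear_combination h2 - h
      ext
      · apply mul_left_cancel₀ hn
        linear_combination u.1 * h - u.2 * h3
      · apply mul_left_cancel₀ hn
        linear_combination u.2 * h + u.1 * h3
    · filter_upwards [hlt q p h] with ε h1 _ using ⟨h1.ne', fun h' => absurd h' h.not_gt⟩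
  obtain ⟨ε, hε⟩ := key.exists
  exact ⟨_, hε⟩

lemma exists_P' (P : Finset Pt) (hgp : GenPos P) (u : Pt) (hu : u ≠ 0) (s k : ℕ) (hk : 3 ≤ k)
    (hks : k + 1 ≤ s) (hcard : 2 * s - 2 < P.card) :
    ∃ P' ⊆ P, P'.card = s - k + 1 ∧ SepByLine (P' : Set Pt) ((P \ P' : Finset Pt) : Set Pt) ∧
      ∀ A, WW P s u A → P' ⊆ A := by
  obtain ⟨v, hv⟩ := perturb P u hu
  obtain ⟨P', hP', hc, hl⟩ := WW_exists P v (s - k + 1) (by omega)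
  have hstrict : ∀ a ∈ P', ∀ b ∈ P, b ∉ P' → FF v a < FF v b := fun a ha b hb hbn =>
    lt_of_le_of_ne (hl a ha b hb hbn) (hv a (hP' ha) b hb (fun h => hbn (h ▸ ha))).1
  refine ⟨P', hP', hc, ?_, ?_⟩
  · have hne : P'.Nonempty := by rw [← Finset.card_pos]; omega
    have hne2 : (P \ P').Nonempty := by
      rw [← Finset.card_pos, Finset.card_sdiff_of_subset hP']; omega
    obtain ⟨x, hx, hmax⟩ := Finset.exists_max_image P' (FF v) hne
    obtain ⟨y, hy, hmin⟩ := Finset.exists_min_image (P \ P') (FF v) hne2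
    have hxy := hstrict x hx y (Finset.mem_sdiff.1 hy).1 (Finset.mem_sdiff.1 hy).2
    refine ⟨v, ?_, (FF v x + FF v y) / 2, ?_, ?_⟩
    · rintro rfl
      simp [FF] at hxy
    · intro p hp
      have := hmax p (by simpa using hp)
      change FF v p < _
      linarith
    · intro p hp
      have := hmin p (Finset.mem_coe.1 hp)
      change _ < FF v p
      linarith
  · rintro A ⟨hA, hAc, hAl⟩ p hp
    by_contra hpA
    refine no_three P hgp u hu (A \ P') (Finset.sdiff_subset.trans hA) ?_ (FF u p) ?_
    · have h1 : (A ∩ P').card < P'.card := by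
        apply Finset.card_lt_card
        refine ⟨Finset.inter_subset_right, fun h => hpA (Finset.mem_inter.1 (h hp)).1⟩
      have h2 := Finset.card_sdiff_add_card_inter A P'
      omega
    · intro a ha
      rw [Finset.mem_sdiff] at ha
      rcases (hAl a ha.1 p (hP' hp) hpA).lt_or_eq with h | h
      · have h1 := hstrict p hp a (hA ha.1) ha.2
        have h2 := (hv a (hA ha.1) p (hP' hp) (fun h => hpA (h ▸ ha.1))).2 h
        exact absurd h1 h2.not_gt
      · exact h

/-- the holes of `A` -/
def HH (k : ℕ) (A : Finset Pt) : Finset (Finset Pt) := A.powerset.filter (fun S => IsHole k A S)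

/-- unit vector -/
def UU (θ : ℝ) : Pt := (Real.cos θ, Real.sin θ)

lemma UU_ne (θ : ℝ) : UU θ ≠ 0 := by
  intro h
  have h1 : Real.cos θ = 0 := congrArg Prod.fst h
  have h2 : Real.sin θ = 0 := congrArg Prod.snd h
  have := Real.sin_sq_add_cos_sq θ
  rw [h1, h2] at this
  norm_num at this

lemma GenPos.mono {P A : Finset Pt} (h : GenPos P) (hA : A ⊆ P) : GenPos A :=
  fun S hS => h S (hS.trans hA)

open Filter Topology in
/-- under the hypotheses `X_k(s−1) ≥ 1` and `X_k(s) ≥ t`, every set `P` of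
more than `2s−2` points in general position contains an `(s−k+1)`-point subset `P'`,
strictly separated from the rest by a line, such that at least `t+1` `k`-holes of `P`
meet `P'`. -/
theorem stmt_4 (k s t : ℕ) (hk : 3 ≤ k) (hks : k + 1 ≤ s) (ht : 1 ≤ t)
    (h1 : ∀ Q : Finset Pt, Q.card = s - 1 → GenPos Q → 1 ≤ numHoles k Q)
    (h2 : ∀ Q : Finset Pt, Q.card = s → GenPos Q → t ≤ numHoles k Q)
    (P : Finset Pt) (hcard : 2 * s - 2 < P.card) (hgp : GenPos P) :
    ∃ P' ⊆ P, P'.card = s - k + 1 ∧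
      SepByLine (P' : Set Pt) ((P \ P' : Finset Pt) : Set Pt) ∧
      t + 1 ≤ (P.powerset.filter (fun S => IsHole k P S ∧ (S ∩ P').Nonempty)).card := by
  by_contra hcon
  have hsP : s ≤ P.card := by omega
  have hsame : ∀ u : Pt, u ≠ 0 → ∀ A B, WW P s u A → WW P s u B → HH k A = HH k B := by
    intro u hu A B hA hB
    obtain ⟨P', hP', hc, hsep, hsub⟩ := exists_P' P hgp u hu s k hk hks hcard
    have hup : ∀ A, WW P s u A →
        HH k A ⊆ P.powerset.filter (fun S => IsHole k P S ∧ (S ∩ P').Nonempty) := by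
      intro A hA S hS
      have hS' : IsHole k A S := (Finset.mem_filter.1 hS).2
      have hSP := hole_up P hgp u hu s k A hA S hS'
      refine Finset.mem_filter.2 ⟨Finset.mem_powerset.2 hSP.1, hSP, ?_⟩
      by_contra hne
      rw [Finset.not_nonempty_iff_eq_empty, ← Finset.disjoint_iff_inter_eq_empty] at hne
      have h3 := Finset.card_le_card (Finset.union_subset hS'.1 (hsub A hA))
      rw [Finset.card_union_of_disjoint hne, hS'.2.1, hA.2.1, hc] at h3
      omega
    have hle : (HH k A ∪ HH k B).card ≤ t := by
      by_contra h
      refine hcon ⟨P', hP', hc, hsep, ?_⟩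
      exact le_trans (by omega)
        (Finset.card_le_card (Finset.union_subset (hup A hA) (hup B hB)))
    have hA2 : t ≤ (HH k A).card := h2 A hA.2.1 (hgp.mono hA.1)
    have hB2 : t ≤ (HH k B).card := h2 B hB.2.1 (hgp.mono hB.1)
    have e1 := Finset.eq_of_subset_of_card_le
      (Finset.subset_union_left (s₁ := HH k A) (s₂ := HH k B)) (by omega)
    have e2 := Finset.eq_of_subset_of_card_le
      (Finset.subset_union_right (s₁ := HH k A) (s₂ := HH k B)) (by omega)
    exact e1.trans e2.symm
  choose W hW using fun θ : ℝ => WW_exists P (UU θ) s hsP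
  have hloc : IsLocallyConstant (fun θ : ℝ => HH k (W θ)) := by
    rw [IsLocallyConstant.iff_eventually_eq]
    intro θ
    have hev : ∀ᶠ φ in 𝓝 θ, ∀ a ∈ P, ∀ b ∈ P,
        FF (UU φ) a ≤ FF (UU φ) b → FF (UU θ) a ≤ FF (UU θ) b := by
      rw [Filter.eventually_all_finset]
      intro a _
      rw [Filter.eventually_all_finset]
      intro b _
      by_cases h : FF (UU θ) a ≤ FF (UU θ) b
      · exact Filter.Eventually.of_forall fun _ _ => h
      · have c : ∀ p : Pt, Continuous fun φ : ℝ => FF (UU φ) p := by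
          intro p; unfold FF UU; fun_prop
        filter_upwards [(c b).continuousAt.eventually_lt (c a).continuousAt (not_le.1 h)]
          with φ h1 h2
        exact absurd h1 h2.not_gt
    filter_upwards [hev] with φ hφ
    refine hsame (UU θ) (UU_ne θ) _ _ ⟨(hW φ).1, (hW φ).2.1, fun a ha b hb hbn => ?_⟩ (hW θ)
    exact hφ a ((hW φ).1 ha) b hb ((hW φ).2.2 a ha b hb hbn)
  have heq : HH k (W 0) = HH k (W Real.pi) := hloc.apply_eq_of_preconnectedSpace 0 Real.pi
  have h0 := hW 0
  have hpi := hW Real.pi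
  have hpos : 0 < (HH k (W 0)).card := lt_of_lt_of_le ht (h2 _ h0.2.1 (hgp.mono h0.1))
  obtain ⟨S, hS⟩ := Finset.card_pos.1 hpos
  have hS0 : IsHole k (W 0) S := (Finset.mem_filter.1 hS).2
  rw [heq] at hS
  have hSpi : IsHole k (W Real.pi) S := (Finset.mem_filter.1 hS).2
  have hint := Finset.card_le_card (Finset.subset_inter hS0.1 hSpi.1)
  have hun := Finset.card_union_add_card_inter (W 0) (W Real.pi)
  rw [h0.2.1, hpi.2.1] at hun
  rw [hS0.2.1] at hint
  obtain ⟨z, hzP, hz⟩ := Finset.exists_mem_notMem_of_card_lt_card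
    (s := W 0 ∪ W Real.pi) (t := P) (by omega)
  rw [Finset.mem_union, not_or] at hz
  refine no_three P hgp (UU 0) (UU_ne 0) S (hS0.1.trans h0.1) (by rw [hS0.2.1]; exact hk)
    (FF (UU 0) z) ?_
  intro p hp
  have i1 := h0.2.2 p (hS0.1 hp) z hzP hz.1
  have i2 := hpi.2.2 p (hSpi.1 hp) z hzP hz.2
  simp only [FF, UU, Real.cos_zero, Real.sin_zero, Real.cos_pi, Real.sin_pi] at i1 i2 ⊢
  linarith
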